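/- arXiv:2305.19207 — 3 statements merged into one kernel-verified Lean document; each statement's English description precedes it below -/
import Mathlib

section
/- For every countable type F there exists a function ψ : F → ℝ such that the map from finite multisets over F to ℝ given by M ↦ ∑_{a ∈ M} ψ a (i.e. (M.map ψ).sum, counting multiplicities) is injective: if two finite multisets M, N over F satisfy (M.map ψ).sum = (N.map ψ).sum, then M = N. -/
/-- The logarithm of a product of positive naturals over a multiset is the sum of logarithms. -/
theorem sum_log_eq_log_prod {F : Type*} (q : F → ℕ) (hq : ∀ a, q a ≠ 0) (M : Multiset F) :
    (M.map fun a => Real.log (q a)).sum = Real.log ((M.map q).prod : ℕ) ∧ (M.map q).prod ≠ 0 := by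
  induction M using Multiset.induction_on with
  | empty => simp
  | cons a s ih =>
    refine ⟨?_, ?_⟩
    · rw [Multiset.map_cons, Multiset.sum_cons, Multiset.map_cons, Multiset.prod_cons, Nat.cast_mul,
        Real.log_mul (by exact_mod_cast hq a) (by exact_mod_cast ih.2), ih.1]
    · rw [Multiset.map_cons, Multiset.prod_cons]
      exact mul_ne_zero (hq a) ih.2

/-- **Step 1 of the expressivity proof.**
For every countable type `F` there is `ψ : F → ℝ` such that the sum of `ψ`
over a finite multiset (with multiplicities) determines the multiset. -/
theorem exists_injective_multiset_sum {F : Type*} [Countable F] :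
    ∃ ψ : F → ℝ, ∀ M N : Multiset F, (M.map ψ).sum = (N.map ψ).sum → M = N := by
  obtain ⟨c, hc⟩ := exists_injective_nat F
  let q : F → ℕ := fun a => Nat.nth Nat.Prime (c a)
  have hp : ∀ a, (q a).Prime := fun a => Nat.prime_nth_prime (c a)
  have hinj : Function.Injective q :=
    (Nat.nth_injective Nat.infinite_setOf_prime).comp hc
  have key : ∀ M : Multiset F,
      UniqueFactorizationMonoid.normalizedFactors (M.map q).prod = M.map q := fun M =>
    UniqueFactorizationMonoid.normalizedFactors_prod_of_prime (by
      intro p h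
      obtain ⟨a, -, rfl⟩ := Multiset.mem_map.1 h
      exact (hp a).prime)
  refine ⟨fun a => Real.log (q a), fun M N h => ?_⟩
  obtain ⟨hM, hM0⟩ := sum_log_eq_log_prod q (fun a => (hp a).ne_zero) M
  obtain ⟨hN, hN0⟩ := sum_log_eq_log_prod q (fun a => (hp a).ne_zero) N
  rw [hM, hN] at h
  have h2 : (M.map q).prod = (N.map q).prod := by
    exact_mod_cast Real.log_injOn_pos
      (Set.mem_Ioi.2 (Nat.cast_pos.2 (Nat.pos_of_ne_zero hM0)))
      (Set.mem_Ioi.2 (Nat.cast_pos.2 (Nat.pos_of_ne_zero hN0))) h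
  apply Multiset.map_injective hinj
  rw [← key M, ← key N, h2]
end

section
/- Let Q be a finite type and A a countable type. There exists a function φ : A → ℝ such that the sum ∑_{q ∈ Q} φ (h q) determines the multiset of values of h: for any h, h' : Q → A, if ∑_{q ∈ Q} φ (h q) = ∑_{q ∈ Q} φ (h' q), then the multiset {h q : q ∈ Q} equals the multiset {h' q : q ∈ Q} (with multiplicities). -/
/-- **Step 2 of the expressivity proof.**
For a finite index type `Q` and countable value type `A`, there is `φ : A → ℝ`
such that `∑_{q ∈ Q} φ (h q)` determines the multiset of values of `h`
(with multiplicities). -/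
theorem exists_sum_determines_value_multiset {Q A : Type*} [Fintype Q] [Countable A] :
    ∃ φ : A → ℝ, ∀ h h' : Q → A,
      (∑ q : Q, φ (h q)) = (∑ q : Q, φ (h' q)) →
        Multiset.map h Finset.univ.val = Multiset.map h' Finset.univ.val := by
  obtain ⟨c, hc⟩ := exists_injective_nat A
  let P : A → ℕ := fun a => Nat.nth Nat.Prime (c a)
  have hP : ∀ a, (P a).Prime := fun a => Nat.prime_nth_prime _
  have hinj : Function.Injective P :=
    (Nat.nth_injective Nat.infinite_setOf_prime).comp hc
  refine ⟨fun a => Real.log (P a), fun h h' heq => ?_⟩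
  have h0 : ∀ a, (P a : ℝ) ≠ 0 := fun a => Nat.cast_ne_zero.mpr (hP a).ne_zero
  have hpos : ∀ g : Q → A, (0 : ℝ) < ∏ q, (P (g q) : ℝ) := fun g =>
    Finset.prod_pos fun q _ => Nat.cast_pos.mpr (hP _).pos
  simp only at heq
  rw [← Real.log_prod (fun q _ => h0 (h q)), ← Real.log_prod (fun q _ => h0 (h' q))] at heq
  have hprod := Real.log_injOn_pos (hpos h) (hpos h') heq
  have hnat : ∏ q, P (h q) = ∏ q, P (h' q) := by exact_mod_cast hprod
  have key : ∀ g : Q → A, UniqueFactorizationMonoid.normalizedFactors (∏ q, P (g q)) =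
      Multiset.map P (Multiset.map g Finset.univ.val) := by
    intro g
    have := UniqueFactorizationMonoid.normalizedFactors_prod_of_prime
      (m := Multiset.map P (Multiset.map g Finset.univ.val)) (by
        intro p hp
        obtain ⟨a, _, rfl⟩ := Multiset.mem_map.mp hp
        exact (hP a).prime)
    rw [← this, Multiset.map_map]
    rfl
  apply Multiset.map_injective hinj
  rw [← key, ← key, hnat]
end

section
/- Let X be a finite type and F a countable type. Then there exists a function ψ : X → F → ℝ such that the map (X → F) → ℝ given by v ↦ ∑_{x ∈ X} ψ x (v x) is injective: if ∑_{x ∈ X} ψ x (v x) = ∑_{x ∈ X} ψ x (w x) for v, w : X → F, then v = w. -/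
/-- **Steps 1–2 combined.**
For a finite type `X` and countable type `F`, there is `ψ : X → F → ℝ` such
that `v ↦ ∑_{x ∈ X} ψ x (v x)` is injective on assignments `v : X → F`. -/
theorem exists_injective_assignment_sum {X F : Type*} [Fintype X] [Countable F] :
    ∃ ψ : X → F → ℝ, ∀ v w : X → F,
      (∑ x : X, ψ x (v x)) = (∑ x : X, ψ x (w x)) → v = w := by
  have : Countable X := Finite.to_countable
  obtain ⟨c, hc⟩ := exists_injective_nat (X × F)
  let p : X × F → ℕ := fun z => Nat.nth Nat.Prime (c z)
  have hp : ∀ z, (p z).Prime := fun z => Nat.prime_nth_prime _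
  have hinj : Function.Injective p :=
    (Nat.nth_injective Nat.infinite_setOf_prime).comp hc
  have hpos : ∀ z, ((p z : ℕ) : ℝ) ≠ 0 := fun z => Nat.cast_ne_zero.mpr (hp z).ne_zero
  refine ⟨fun x a => Real.log (p (x, a)), fun v w h => ?_⟩
  rw [← Real.log_prod (fun x _ => hpos _), ← Real.log_prod (fun x _ => hpos _)] at h
  have hpp : ∀ u : X → F, (0 : ℝ) < ∏ x, (p (x, u x) : ℝ) := fun u =>
    Finset.prod_pos fun x _ => Nat.cast_pos.mpr (hp _).pos
  have h2 := Real.log_injOn_pos (hpp v) (hpp w) h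
  have h3 : ∏ x, p (x, v x) = ∏ x, p (x, w x) := by exact_mod_cast h2
  funext x
  have hd : p (x, v x) ∣ ∏ y, p (y, w y) :=
    h3 ▸ Finset.dvd_prod_of_mem (fun y => p (y, v y)) (Finset.mem_univ x)
  obtain ⟨y, -, hy⟩ := ((hp _).prime.dvd_finset_prod_iff _).mp hd
  have he := hinj ((Nat.prime_dvd_prime_iff_eq (hp _) (hp _)).mp hy)
  obtain ⟨rfl, h5⟩ := Prod.mk.inj he
  exact h5
end
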